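/- arXiv:2303.08381 — 2 statements merged into one kernel-verified Lean document; each statement's English description precedes it below -/
import Mathlib

section
/- Let x: U → ℝ³ be a smooth immersed surface with unit normal N whose image x(U) is contained in a circular cylinder {y ∈ ℝ³ : |(y − c) − ⟨y − c, w⟩w| = ρ} (c ∈ ℝ³, w a unit vector, ρ > 0). Then the normal bundle immersion f(p,t) = (x(p), t·N(p)) is a Maslovian Lagrangian immersion into ℂ³. -/
noncomputable section

open scoped InnerProductSpace

/-- Euclidean 3-space. -/
abbrev E3 : Type := EuclideanSpace ℝ (Fin 3)

/-- ℝ⁶ = ℝ³ × ℝ³, identified with ℂ³. -/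
abbrev V6 : Type := E3 × E3

/-- The domain of the normal bundle immersion: ℝ² × ℝ. -/
abbrev W3 : Type := (ℝ × ℝ) × ℝ

/-- The standard inner product on ℝ⁶ = ℝ³ × ℝ³. -/
def ip6 (v w : V6) : ℝ := ⟪v.1, w.1⟫_ℝ + ⟪v.2, w.2⟫_ℝ

/-- The complex structure J(X, Y) = (−Y, X) on ℝ³ × ℝ³ = ℂ³. -/
def Jc (v : V6) : V6 := (-v.2, v.1)

/-- The normal bundle immersion f(p, t) = (x(p), t·N(p)). -/
def nbi (x N : ℝ × ℝ → E3) : W3 → V6 := fun q => (x q.1, q.2 • N q.1)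

/-- Second derivative of `g` at `q` in directions `v`, `w`. -/
def d2 (g : W3 → V6) (q v w : W3) : V6 := fderiv ℝ (fun y => fderiv ℝ g y w) q v

/-- `n` is orthogonal to the tangent space (range of the differential) of `g` at `q`. -/
def IsNormalAt (g : W3 → V6) (q : W3) (n : V6) : Prop :=
  ∀ v : W3, ip6 n (fderiv ℝ g q v) = 0

/-- `n` is the second fundamental form `h(v, w)` of `g` at `q`: the orthogonal projection of
the second derivative in directions `v`, `w` onto the orthogonal complement of the tangent
space. -/
def IsSFF (g : W3 → V6) (q v w : W3) (n : V6) : Prop :=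
  IsNormalAt g q n ∧ d2 g q v w - n ∈ Set.range ⇑(fderiv ℝ g q)

/-- `v₁, v₂, v₃` is an orthonormal frame at `q` for the metric induced by `g`. -/
def ONFrame (g : W3 → V6) (q : W3) (v₁ v₂ v₃ : W3) : Prop :=
  ip6 (fderiv ℝ g q v₁) (fderiv ℝ g q v₁) = 1 ∧
  ip6 (fderiv ℝ g q v₂) (fderiv ℝ g q v₂) = 1 ∧
  ip6 (fderiv ℝ g q v₃) (fderiv ℝ g q v₃) = 1 ∧
  ip6 (fderiv ℝ g q v₁) (fderiv ℝ g q v₂) = 0 ∧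
  ip6 (fderiv ℝ g q v₁) (fderiv ℝ g q v₃) = 0 ∧
  ip6 (fderiv ℝ g q v₂) (fderiv ℝ g q v₃) = 0

/-- `Hq` is the mean curvature vector of `g` at `q`:
`H = Σᵢ h(ẽᵢ, ẽᵢ)` for an orthonormal frame `ẽ₁, ẽ₂, ẽ₃` of the induced metric. -/
def IsMeanCurvAt (g : W3 → V6) (q : W3) (Hq : V6) : Prop :=
  ∃ v₁ v₂ v₃ : W3, ONFrame g q v₁ v₂ v₃ ∧
    ∃ n₁ n₂ n₃ : V6, IsSFF g q v₁ v₁ n₁ ∧ IsSFF g q v₂ v₂ n₂ ∧ IsSFF g q v₃ v₃ n₃ ∧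
      Hq = n₁ + n₂ + n₃

/-- `u = A_ξ v`, the shape operator of `g` at `q` with respect to the normal vector `ξ`,
characterized by `⟨dg(A_ξ v), dg(w)⟩ = ⟨h(v, w), ξ⟩` for all `w`. -/
def IsShapeAt (g : W3 → V6) (q : W3) (ξ : V6) (v u : W3) : Prop :=
  ∀ w : W3, ∀ n : V6, IsSFF g q v w n →
    ip6 (fderiv ℝ g q u) (fderiv ℝ g q w) = ip6 n ξ

/-- `g` is a Lagrangian immersion at `q`: the differential is injective and `J` maps the
tangent space onto its orthogonal complement. -/
def LagrangianAt (g : W3 → V6) (q : W3) : Prop :=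
  Function.Injective ⇑(fderiv ℝ g q) ∧
    Jc '' Set.range ⇑(fderiv ℝ g q) =
      {u : V6 | ∀ w ∈ Set.range ⇑(fderiv ℝ g q), ip6 u w = 0}

/-- The Maslovian condition at `q` for the mean curvature vector `Hq`: `Hq ≠ 0` and
`A_H(JH)` is a real scalar multiple of `JH` (expressed via the tangent vector `V`
with `dg(V) = J Hq`). -/
def MaslovianAt (g : W3 → V6) (q : W3) (Hq : V6) : Prop :=
  Hq ≠ 0 ∧ ∀ V u : W3, fderiv ℝ g q V = Jc Hq → IsShapeAt g q Hq V u → ∃ c : ℝ, u = c • V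

/-- Standard hypotheses: `U` is a connected open set, `x` is a smooth immersion on `U`, and
`N` is a smooth unit normal field along `x` on `U`. -/
structure SurfaceData (U : Set (ℝ × ℝ)) (x N : ℝ × ℝ → E3) : Prop where
  open_U : IsOpen U
  conn_U : IsConnected U
  smooth_x : ContDiffOn ℝ (⊤ : ℕ∞) x U
  smooth_N : ContDiffOn ℝ (⊤ : ℕ∞) N U
  immersion : ∀ p ∈ U, Function.Injective ⇑(fderiv ℝ x p)
  unit_N : ∀ p ∈ U, ‖N p‖ = 1
  normal_N : ∀ p ∈ U, ∀ v : ℝ × ℝ, ⟪N p, fderiv ℝ x p v⟫_ℝ = 0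

/-- `x` is minimal at `p`: the trace of the shape operator `A = −dN ∘ dx⁻¹` vanishes,
expressed via orthonormal frames of the induced metric. -/
def SurfMinimalAt (x N : ℝ × ℝ → E3) (p : ℝ × ℝ) : Prop :=
  ∀ v₁ v₂ : ℝ × ℝ,
    ⟪fderiv ℝ x p v₁, fderiv ℝ x p v₁⟫_ℝ = 1 →
    ⟪fderiv ℝ x p v₂, fderiv ℝ x p v₂⟫_ℝ = 1 →
    ⟪fderiv ℝ x p v₁, fderiv ℝ x p v₂⟫_ℝ = 0 →
    ⟪fderiv ℝ N p v₁, fderiv ℝ x p v₁⟫_ℝ + ⟪fderiv ℝ N p v₂, fderiv ℝ x p v₂⟫_ℝ = 0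

/-- A rigid motion of ℝ³: `y ↦ S y + c` with `S ∈ SO(3)`. -/
def RigidMotion (Φ : E3 → E3) : Prop :=
  ∃ (S : E3 ≃ₗᵢ[ℝ] E3) (c : E3),
    LinearMap.det (S.toLinearEquiv : E3 →ₗ[ℝ] E3) = 1 ∧ ∀ y, Φ y = S y + c

/-- The circular cone `C_r = {(s·r·cos θ, s·r·sin θ, s)/√(r²+1) : s > 0, θ ∈ ℝ}`. -/
def coneSet (r : ℝ) : Set E3 :=
  { y | ∃ s θ : ℝ, 0 < s ∧
      y 0 = s * r * Real.cos θ / Real.sqrt (r ^ 2 + 1) ∧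
      y 1 = s * r * Real.sin θ / Real.sqrt (r ^ 2 + 1) ∧
      y 2 = s / Real.sqrt (r ^ 2 + 1) }

/-- `x(U)` is contained in a round sphere. -/
def InRoundSphere (U : Set (ℝ × ℝ)) (x : ℝ × ℝ → E3) : Prop :=
  ∃ (c : E3) (ρ : ℝ), 0 < ρ ∧ ∀ p ∈ U, ‖x p - c‖ = ρ

/-- `x(U)` is contained in a circular cylinder. -/
def InCircularCylinder (U : Set (ℝ × ℝ)) (x : ℝ × ℝ → E3) : Prop :=
  ∃ (c w : E3) (ρ : ℝ), ‖w‖ = 1 ∧ 0 < ρ ∧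
    ∀ p ∈ U, ‖(x p - c) - ⟪x p - c, w⟫_ℝ • w‖ = ρ

/-- `x(U)` is contained in a circular cone: the image under a rigid motion of `C_r`, `r ≠ 0`. -/
def InCircularCone (U : Set (ℝ × ℝ)) (x : ℝ × ℝ → E3) : Prop :=
  ∃ r : ℝ, r ≠ 0 ∧ ∃ Φ : E3 → E3, RigidMotion Φ ∧ ∀ p ∈ U, x p ∈ Φ '' coneSet r

section Frame

variable {w τ N : E3}

/-- `w, τ, N` is an orthonormal frame of Euclidean 3-space. -/
structure IsOrthoFrame (w τ N : E3) : Prop where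
  ww : ⟪w, w⟫_ℝ = 1
  ττ : ⟪τ, τ⟫_ℝ = 1
  NN : ⟪N, N⟫_ℝ = 1
  wτ : ⟪w, τ⟫_ℝ = 0
  τw : ⟪τ, w⟫_ℝ = 0
  wN : ⟪w, N⟫_ℝ = 0
  Nw : ⟪N, w⟫_ℝ = 0
  τN : ⟪τ, N⟫_ℝ = 0
  Nτ : ⟪N, τ⟫_ℝ = 0
  expand : ∀ v : E3, v = ⟪w, v⟫_ℝ • w + ⟪τ, v⟫_ℝ • τ + ⟪N, v⟫_ℝ • N

/-- Two orthogonal unit vectors of Euclidean 3-space extend to an orthonormal frame. -/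
lemma exists_isOrthoFrame (hw : ⟪w, w⟫_ℝ = 1) (hN : ⟪N, N⟫_ℝ = 1) (hwN : ⟪w, N⟫_ℝ = 0) :
    ∃ τ : E3, IsOrthoFrame w τ N := by
  have hNw : ⟪N, w⟫_ℝ = 0 := by rw [real_inner_comm, hwN]
  have hon : Orthonormal ℝ (({0, 2} : Set (Fin 3)).domRestrict ![w, 0, N]) := by
    rw [orthonormal_iff_ite]
    rintro ⟨i, hi⟩ ⟨j, hj⟩
    simp only [Set.domRestrict_apply, Subtype.mk.injEq]
    rcases hi with rfl | rfl <;> rcases hj with rfl | rfl <;>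
      simp [-inner_self_eq_norm_sq_to_K, hw, hN, hwN, hNw]
  obtain ⟨b, hb⟩ := hon.exists_orthonormalBasis_extension_of_card_eq (by simp)
  have h0 : b 0 = w := by simpa using hb 0 (by simp)
  have h2 : b 2 = N := by simpa using hb 2 (by simp)
  have h (i j : Fin 3) : ⟪b i, b j⟫_ℝ = if i = j then 1 else 0 :=
    orthonormal_iff_ite.1 b.orthonormal i j
  refine ⟨b 1, hw, by simp, hN, by simp [← h0, h], by simp [← h0, h], hwN, hNw,
    by simp [← h2, h], by simp [← h2, h], fun v => ?_⟩
  have := (b.sum_repr' v).symm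
  rwa [Fin.sum_univ_three, h0, h2] at this

/-- An injective linear map from the plane into 3-space with unit normal `N` is onto `Nᗮ`. -/
lemma exists_preimage_of_inner_eq_zero {L : ℝ × ℝ →L[ℝ] E3} (hL : Function.Injective L)
    (hN : ⟪N, N⟫_ℝ = 1) (hLN : ∀ a, ⟪N, L a⟫_ℝ = 0) {v : E3} (hv : ⟪N, v⟫_ℝ = 0) :
    ∃ a, L a = v := by
  have hN0 : N ≠ 0 := by rintro rfl; simp at hN
  have hle : L.toLinearMap.range ≤ (ℝ ∙ N)ᗮ := by
    rintro _ ⟨a, rfl⟩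
    exact Submodule.mem_orthogonal_singleton_iff_inner_right.2 (hLN a)
  have h1 : Module.finrank ℝ L.toLinearMap.range = 2 := by
    rw [LinearMap.finrank_range_of_inj hL]; simp
  have h2 : Module.finrank ℝ (ℝ ∙ N)ᗮ = 2 := by
    have : Fact (Module.finrank ℝ E3 = 2 + 1) := ⟨by simp⟩
    exact Submodule.finrank_orthogonal_span_singleton hN0
  have heq := Submodule.eq_of_le_of_finrank_eq hle (h1.trans h2.symm)
  have : v ∈ L.toLinearMap.range := by
    rw [heq]; exact Submodule.mem_orthogonal_singleton_iff_inner_right.2 hv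
  exact this

lemma eq_inner_smul_of_orthogonal_range {L : ℝ × ℝ →L[ℝ] E3} (hL : Function.Injective L)
    (hN : ⟪N, N⟫_ℝ = 1) (hLN : ∀ a, ⟪N, L a⟫_ℝ = 0) {y : E3} (hy : ∀ a, ⟪y, L a⟫_ℝ = 0) :
    y = ⟪N, y⟫_ℝ • N := by
  have h : ⟪N, y - ⟪N, y⟫_ℝ • N⟫_ℝ = 0 := by
    rw [inner_sub_right, inner_smul_right, hN, mul_one, sub_self]
  obtain ⟨a, ha⟩ := exists_preimage_of_inner_eq_zero hL hN hLN h
  have hperp : ⟪y - ⟪N, y⟫_ℝ • N, L a⟫_ℝ = 0 := by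
    simp [inner_sub_left, inner_smul_left, hLN, hy]
  rwa [ha, inner_self_eq_zero, sub_eq_zero] at hperp

end Frame

/-- The orthogonal projection onto the complement of `w`, when `w` is a unit vector. -/
def projPerp (w : E3) : E3 →L[ℝ] E3 :=
  ContinuousLinearMap.id ℝ E3 - (innerSL ℝ w).smulRight w

lemma projPerp_apply (w v : E3) : projPerp w v = v - ⟪w, v⟫_ℝ • w := by
  simp [projPerp]

lemma inner_projPerp_left (w u v : E3) (hw : ⟪w, w⟫_ℝ = 1) :
    ⟪projPerp w u, projPerp w v⟫_ℝ = ⟪projPerp w u, v⟫_ℝ := by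
  simp only [projPerp_apply, inner_sub_left, inner_sub_right, inner_smul_left, inner_smul_right,
    hw, real_inner_comm w, conj_trivial]
  ring

section Cylinder

variable {U : Set (ℝ × ℝ)} {x N : ℝ × ℝ → E3}

/-- A surface in a circular cylinder has as unit normal a constant multiple of the radial
vector. -/
lemma SurfaceData.exists_normal_eq_smul (hS : SurfaceData U x N) {c w : E3} {ρ : ℝ}
    (hw : ⟪w, w⟫_ℝ = 1) (hρ : 0 < ρ) (hcyl : ∀ p ∈ U, ‖projPerp w (x p - c)‖ = ρ) :
    ∃ k : ℝ, k ≠ 0 ∧ ∀ p ∈ U, N p = k • projPerp w (x p - c) := by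
  have hdx : ∀ p ∈ U, DifferentiableAt ℝ x p := fun p hp =>
    (hS.smooth_x.contDiffAt (hS.open_U.mem_nhds hp)).differentiableAt (by simp)
  have hNN : ∀ p ∈ U, ⟪N p, N p⟫_ℝ = 1 := fun p hp => by
    rw [real_inner_self_eq_norm_sq, hS.unit_N p hp]; norm_num
  have hy : ∀ p ∈ U, ∀ a, ⟪projPerp w (x p - c), fderiv ℝ x p a⟫_ℝ = 0 := by
    intro p hp a
    have h1 : HasFDerivAt (fun p => projPerp w (x p - c)) ((projPerp w).comp (fderiv ℝ x p)) p :=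
      (projPerp w).hasFDerivAt.comp p ((hdx p hp).hasFDerivAt.sub_const c)
    have h2 := h1.norm_sq
    have h3 : (fun p => ‖projPerp w (x p - c)‖ ^ 2) =ᶠ[nhds p] fun _ => ρ ^ 2 := by
      filter_upwards [hS.open_U.mem_nhds hp] with p hp
      rw [hcyl p hp]
    have h4 := h2.unique ((hasFDerivAt_const (ρ ^ 2) p).congr_of_eventuallyEq h3)
    have h5 := congrArg (fun T => T a) h4
    simpa [inner_projPerp_left _ _ _ hw, inner_sub_left] using h5
  have hyN : ∀ p ∈ U, projPerp w (x p - c) = ⟪N p, projPerp w (x p - c)⟫_ℝ • N p := fun p hp =>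
    eq_inner_smul_of_orthogonal_range (hS.immersion p hp) (hNN p hp) (hS.normal_N p hp) (hy p hp)
  have hsq : Set.EqOn ((fun p => ⟪N p, projPerp w (x p - c)⟫_ℝ) ^ 2) ((fun _ => ρ) ^ 2) U := by
    intro p hp
    have h := congrArg (fun v => ‖v‖) (hyN p hp)
    simp only [norm_smul, hS.unit_N p hp, hcyl p hp, mul_one] at h
    simp [h]
  have hcont : ContinuousOn (fun p => ⟪N p, projPerp w (x p - c)⟫_ℝ) U :=
    hS.smooth_N.continuousOn.inner
      ((projPerp w).continuous.comp_continuousOn (hS.smooth_x.continuousOn.sub continuousOn_const))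
  have key : ∀ r : ℝ, r ≠ 0 → (∀ p ∈ U, ⟪N p, projPerp w (x p - c)⟫_ℝ = r) →
      ∃ k : ℝ, k ≠ 0 ∧ ∀ p ∈ U, N p = k • projPerp w (x p - c) := by
    refine fun r hr h => ⟨r⁻¹, inv_ne_zero hr, fun p hp => ?_⟩
    rw [hyN p hp, h p hp, inv_smul_smul₀ hr]
  rcases hS.conn_U.isPreconnected.eq_or_eq_neg_of_sq_eq hcont continuousOn_const hsq
    (fun _ => hρ.ne') with h | h
  · exact key ρ hρ.ne' h
  · exact key (-ρ) (neg_ne_zero.2 hρ.ne') h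

variable {c w : E3} {k : ℝ}

lemma SurfaceData.fderiv_nbi (hS : SurfaceData U x N)
    (hk : ∀ p ∈ U, N p = k • projPerp w (x p - c)) {q : W3} (hq : q.1 ∈ U) (v : W3) :
    fderiv ℝ (nbi x N) q v =
      (fderiv ℝ x q.1 v.1, (q.2 * k) • projPerp w (fderiv ℝ x q.1 v.1) + v.2 • N q.1) := by
  have hdx : HasFDerivAt x (fderiv ℝ x q.1) q.1 :=
    ((hS.smooth_x.contDiffAt (hS.open_U.mem_nhds hq)).differentiableAt (by simp)).hasFDerivAt
  have h1 : HasFDerivAt (fun y : W3 => x y.1)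
      ((fderiv ℝ x q.1).comp (ContinuousLinearMap.fst ℝ (ℝ × ℝ) ℝ)) q :=
    hdx.comp q hasFDerivAt_fst
  have h2 := (((projPerp w).hasFDerivAt.comp q (h1.sub_const c)).const_smul k)
  have h3 := h1.prodMk ((hasFDerivAt_snd (p := q)).smul h2)
  have h4 : nbi x N =ᶠ[nhds q] fun y => (x y.1, y.2 • k • projPerp w (x y.1 - c)) := by
    filter_upwards [(hS.open_U.preimage continuous_fst).mem_nhds hq] with y hy
    simp only [nbi, hk y.1 hy]
  have h5 : HasFDerivAt (nbi x N) _ q := h3.congr_of_eventuallyEq h4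
  rw [h5.fderiv, hk q.1 hq]
  simp [mul_smul]

lemma SurfaceData.d2_nbi (hS : SurfaceData U x N)
    (hk : ∀ p ∈ U, N p = k • projPerp w (x p - c)) {q : W3} (hq : q.1 ∈ U) (v v' : W3) :
    d2 (nbi x N) q v v' =
      (fderiv ℝ (fderiv ℝ x) q.1 v.1 v'.1,
        (v.2 * k) • projPerp w (fderiv ℝ x q.1 v'.1) +
          (v'.2 * k) • projPerp w (fderiv ℝ x q.1 v.1) +
          (q.2 * k) • projPerp w (fderiv ℝ (fderiv ℝ x) q.1 v.1 v'.1)) := by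
  have hcx := hS.smooth_x.contDiffAt (hS.open_U.mem_nhds hq)
  have hdx : HasFDerivAt x (fderiv ℝ x q.1) q.1 := (hcx.differentiableAt (by simp)).hasFDerivAt
  have hddx : HasFDerivAt (fderiv ℝ x) (fderiv ℝ (fderiv ℝ x) q.1) q.1 :=
    ((hcx.fderiv_right (m := 1) (by norm_cast)).differentiableAt (by simp)).hasFDerivAt
  have h0 : HasFDerivAt (fun y : W3 => x y.1)
      ((fderiv ℝ x q.1).comp (ContinuousLinearMap.fst ℝ (ℝ × ℝ) ℝ)) q :=
    hdx.comp q hasFDerivAt_fst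
  have h1 : HasFDerivAt (fun y : W3 => fderiv ℝ x y.1 v'.1)
      (((fderiv ℝ (fderiv ℝ x) q.1).flip v'.1).comp (ContinuousLinearMap.fst ℝ (ℝ × ℝ) ℝ)) q :=
    (((ContinuousLinearMap.apply ℝ E3 v'.1).hasFDerivAt.comp q.1 hddx)).comp q
      hasFDerivAt_fst
  have h2 := (projPerp w).hasFDerivAt.comp q h1
  have h2' := ((projPerp w).hasFDerivAt.comp q (h0.sub_const c)).const_smul k
  have h3 := h1.prodMk ((((hasFDerivAt_snd (p := q)).mul_const k).smul h2).add
    (h2'.const_smul v'.2))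
  have h4 : (fun y => fderiv ℝ (nbi x N) y v') =ᶠ[nhds q] fun y =>
      (fderiv ℝ x y.1 v'.1, (y.2 * k) • projPerp w (fderiv ℝ x y.1 v'.1) +
        v'.2 • k • projPerp w (x y.1 - c)) := by
    filter_upwards [(hS.open_U.preimage continuous_fst).mem_nhds hq] with y hy
    rw [hS.fderiv_nbi hk hy, hk y.1 hy]
  have h5 : HasFDerivAt (fun y => fderiv ℝ (nbi x N) y v') _ q := h3.congr_of_eventuallyEq h4
  rw [d2, h5.fderiv]
  simp [mul_smul, smul_comm k]
  abel

lemma SurfaceData.inner_normal_fderiv_fderiv (hS : SurfaceData U x N)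
    (hk : ∀ p ∈ U, N p = k • projPerp w (x p - c)) {p : ℝ × ℝ} (hp : p ∈ U) (a b : ℝ × ℝ) :
    ⟪N p, fderiv ℝ (fderiv ℝ x) p a b⟫_ℝ =
      -(k * ⟪projPerp w (fderiv ℝ x p a), fderiv ℝ x p b⟫_ℝ) := by
  have hcx := hS.smooth_x.contDiffAt (hS.open_U.mem_nhds hp)
  have hdx : HasFDerivAt x (fderiv ℝ x p) p := (hcx.differentiableAt (by simp)).hasFDerivAt
  have hddx : HasFDerivAt (fderiv ℝ x) (fderiv ℝ (fderiv ℝ x) p) p :=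
    ((hcx.fderiv_right (m := 1) (by norm_cast)).differentiableAt (by simp)).hasFDerivAt
  have h1 : HasFDerivAt (fun y => fderiv ℝ x y b) ((fderiv ℝ (fderiv ℝ x) p).flip b) p :=
    (ContinuousLinearMap.apply ℝ E3 b).hasFDerivAt.comp p hddx
  have h2 := ((projPerp w).hasFDerivAt.comp p (hdx.sub_const c)).const_smul k
  have h3 := h2.inner ℝ h1
  have h4 : (fun y => ⟪k • projPerp w (x y - c), fderiv ℝ x y b⟫_ℝ) =ᶠ[nhds p] fun _ => 0 := by
    filter_upwards [hS.open_U.mem_nhds hp] with y hy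
    rw [← hk y hy, hS.normal_N y hy]
  have h5 := h3.unique ((hasFDerivAt_const (0 : ℝ) p).congr_of_eventuallyEq h4)
  have h6 := congrArg (fun T => T a) h5
  simp [inner_smul_left] at h6
  rw [hk p hp, inner_smul_left]
  simp
  linarith

end Cylinder

section PointwiseAlgebra

lemma ip6_add_left (u v z : V6) : ip6 (u + v) z = ip6 u z + ip6 v z := by
  simp only [ip6, Prod.fst_add, Prod.snd_add, inner_add_left]; ring

lemma ip6_sub_left (u v z : V6) : ip6 (u - v) z = ip6 u z - ip6 v z := by
  simp only [ip6, Prod.fst_sub, Prod.snd_sub, inner_sub_left]; ring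

lemma eq_zero_of_ip6_self_eq_zero {u : V6} (h : ip6 u u = 0) : u = 0 := by
  obtain ⟨h1, h2⟩ :=
    (add_eq_zero_iff_of_nonneg real_inner_self_nonneg real_inner_self_nonneg).1 h
  exact Prod.ext (inner_self_eq_zero.1 h1) (inner_self_eq_zero.1 h2)

/-- The vector of ℝ⁶ with prescribed coordinates in the frame
`(w, 0)`, `(τ, m • τ)`, `(0, N)`. -/
def tangentVec (w τ N : E3) (m α β s : ℝ) : V6 := (α • w + β • τ, (m * β) • τ + s • N)

/-- The columns of a `3 × 3` matrix with orthonormal rows are orthonormal; the second column is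
scaled by a factor `c` with `c ^ 2 = 1 + m ^ 2`. -/
lemma sum_sq_of_orthonormal_rows {m : ℝ} {α β s : Fin 3 → ℝ}
    (h : ∀ i j, α i * α j + (1 + m ^ 2) * (β i * β j) + s i * s j = if i = j then 1 else 0) :
    (1 + m ^ 2) * ∑ i, β i ^ 2 = 1 ∧ ∑ i, s i * β i = 0 := by
  have hc : Real.sqrt (1 + m ^ 2) * Real.sqrt (1 + m ^ 2) = 1 + m ^ 2 :=
    Real.mul_self_sqrt (by positivity)
  have hc0 : Real.sqrt (1 + m ^ 2) ≠ 0 := (Real.sqrt_pos.2 (by positivity)).ne'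
  set c := Real.sqrt (1 + m ^ 2)
  let M : Matrix (Fin 3) (Fin 3) ℝ := Matrix.of fun i => ![α i, c * β i, s i]
  have hM : M * M.transpose = 1 := by
    ext i j
    rw [Matrix.mul_apply, Fin.sum_univ_three, Matrix.one_apply, ← h i j, ← hc]
    simp only [M, Matrix.transpose_apply, Matrix.of_apply, Matrix.cons_val]
    ring
  have hM' := mul_eq_one_comm.1 hM
  have h11 := congrFun (congrFun hM' 1) 1
  have h21 := congrFun (congrFun hM' 2) 1
  simp only [M, Matrix.mul_apply, Fin.sum_univ_three, Matrix.transpose_apply, Matrix.of_apply,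
    Matrix.cons_val, Matrix.one_apply, if_true, if_neg (show (2 : Fin 3) ≠ 1 by decide)] at h11 h21
  constructor
  · rw [Fin.sum_univ_three, ← hc]; linarith
  · rw [Fin.sum_univ_three]
    apply mul_left_cancel₀ hc0
    linarith

variable {w τ N : E3}

namespace IsOrthoFrame

lemma ip6_tangentVec (h : IsOrthoFrame w τ N) (m α β s α' β' s' : ℝ) :
    ip6 (tangentVec w τ N m α β s) (tangentVec w τ N m α' β' s') =
      α * α' + (1 + m ^ 2) * (β * β') + s * s' := by
  simp only [ip6, tangentVec, inner_add_left, inner_add_right, inner_smul_left, inner_smul_right,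
    h.ww, h.ττ, h.NN, h.wτ, h.τw, h.τN, h.Nτ, conj_trivial]
  ring

lemma ip6_Jc_tangentVec_Jc_tangentVec (h : IsOrthoFrame w τ N) (m α β s α' β' s' : ℝ) :
    ip6 (Jc (tangentVec w τ N m α β s)) (Jc (tangentVec w τ N m α' β' s')) =
      α * α' + (1 + m ^ 2) * (β * β') + s * s' := by
  rw [← h.ip6_tangentVec]
  simp only [ip6, Jc, inner_neg_neg]
  ring

lemma ip6_tangentVec_Jc_tangentVec (h : IsOrthoFrame w τ N) (m α β s α' β' s' : ℝ) :
    ip6 (tangentVec w τ N m α β s) (Jc (tangentVec w τ N m α' β' s')) = 0 := by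
  simp only [ip6, Jc, tangentVec, inner_add_left, inner_add_right, inner_smul_left,
    inner_smul_right, inner_neg_right, h.ττ, h.wτ, h.τw, h.wN, h.Nw, h.τN, h.Nτ,
    conj_trivial]
  ring

lemma ip6_Jc_tangentVec_tangentVec (h : IsOrthoFrame w τ N) (m α β s α' β' s' : ℝ) :
    ip6 (Jc (tangentVec w τ N m α β s)) (tangentVec w τ N m α' β' s') = 0 := by
  rw [← h.ip6_tangentVec_Jc_tangentVec m α' β' s' α β s]
  simp only [ip6, real_inner_comm]

lemma exists_eq_Jc_tangentVec (h : IsOrthoFrame w τ N) {m : ℝ} {n : V6}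
    (hn : ∀ α β s, ip6 n (tangentVec w τ N m α β s) = 0) :
    ∃ α β s, n = Jc (tangentVec w τ N m α β s) := by
  obtain ⟨a, b⟩ := n
  have h1 := hn 1 0 0
  have h2 := hn 0 1 0
  have h3 := hn 0 0 1
  simp only [ip6, tangentVec, inner_add_right, inner_smul_right, real_inner_comm w,
    real_inner_comm τ, real_inner_comm N] at h1 h2 h3
  have hwa : ⟪w, a⟫_ℝ = 0 := by linarith
  have hNb : ⟪N, b⟫_ℝ = 0 := by linarith
  have hτa : ⟪τ, a⟫_ℝ = -(m * ⟪τ, b⟫_ℝ) := by linarith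
  refine ⟨⟪w, b⟫_ℝ, ⟪τ, b⟫_ℝ, -⟪N, a⟫_ℝ, Prod.ext ?_ ?_⟩
  · refine (h.expand a).trans ?_
    rw [hwa, hτa]
    simp only [Jc, tangentVec]
    module
  · refine (h.expand b).trans ?_
    rw [hNb]
    simp only [Jc, tangentVec]
    module

end IsOrthoFrame

/-- First and second order data at `q` of the normal bundle immersion of a surface in a circular
cylinder with axis direction `w`, in the orthonormal frame `w, τ, N`. Here `k` is the principal
curvature in direction `τ`, up to sign, and `m` is `k` times the height of `q` in the fibre. -/
structure IsCylinderJet (g : W3 → V6) (q : W3) (w τ N : E3) (k m : ℝ) : Prop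
    extends IsOrthoFrame w τ N where
  k_ne_zero : k ≠ 0
  injective : Function.Injective (fderiv ℝ g q)
  fderiv_eq : ∀ v, fderiv ℝ g q v =
    tangentVec w τ N m ⟪w, (fderiv ℝ g q v).1⟫_ℝ ⟪τ, (fderiv ℝ g q v).1⟫_ℝ v.2
  exists_fderiv_eq : ∀ α β s, ∃ v, fderiv ℝ g q v = tangentVec w τ N m α β s
  fderiv_vertical : ∀ s, fderiv ℝ g q (0, s) = tangentVec w τ N m 0 0 s
  d2_self : ∀ v α β s, ip6 (d2 g q v v) (Jc (tangentVec w τ N m α β s)) =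
    s * k * ⟪τ, (fderiv ℝ g q v).1⟫_ℝ ^ 2 + 2 * k * β * (v.2 * ⟪τ, (fderiv ℝ g q v).1⟫_ℝ)
  d2_vertical : ∀ (s : ℝ) v, d2 g q (0, s) v = (0, (s * k * ⟪τ, (fderiv ℝ g q v).1⟫_ℝ) • τ)

namespace IsCylinderJet

variable {g : W3 → V6} {q : W3} {k m : ℝ}

lemma exists_eq_Jc_tangentVec_of_isNormalAt (h : IsCylinderJet g q w τ N k m) {n : V6}
    (hn : IsNormalAt g q n) : ∃ α β s, n = Jc (tangentVec w τ N m α β s) := by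
  refine h.exists_eq_Jc_tangentVec fun α β s => ?_
  obtain ⟨v, hv⟩ := h.exists_fderiv_eq α β s
  rw [← hv]
  exact hn v

lemma isNormalAt_Jc_tangentVec (h : IsCylinderJet g q w τ N k m) (α β s : ℝ) :
    IsNormalAt g q (Jc (tangentVec w τ N m α β s)) := fun v => by
  rw [h.fderiv_eq v, h.ip6_Jc_tangentVec_tangentVec]

lemma lagrangianAt (h : IsCylinderJet g q w τ N k m) : LagrangianAt g q := by
  refine ⟨h.injective, Set.Subset.antisymm ?_ ?_⟩
  · rintro _ ⟨_, ⟨v, rfl⟩, rfl⟩ _ ⟨v', rfl⟩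
    rw [h.fderiv_eq v]
    exact h.isNormalAt_Jc_tangentVec _ _ _ v'
  · intro n hn
    obtain ⟨α, β, s, rfl⟩ := h.exists_eq_Jc_tangentVec_of_isNormalAt fun v => hn _ ⟨v, rfl⟩
    obtain ⟨v, hv⟩ := h.exists_fderiv_eq α β s
    exact ⟨_, ⟨v, rfl⟩, by rw [hv]⟩

lemma ip6_sff_self (h : IsCylinderJet g q w τ N k m) {v : W3} {n : V6} (hn : IsSFF g q v v n)
    (α β s : ℝ) : ip6 n (Jc (tangentVec w τ N m α β s)) =
      s * k * ⟪τ, (fderiv ℝ g q v).1⟫_ℝ ^ 2 + 2 * k * β * (v.2 * ⟪τ, (fderiv ℝ g q v).1⟫_ℝ) := by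
  obtain ⟨z, hz⟩ := hn.2
  have h1 := ip6_sub_left (d2 g q v v) n (Jc (tangentVec w τ N m α β s))
  rw [← hz, h.fderiv_eq z, h.ip6_tangentVec_Jc_tangentVec, h.d2_self] at h1
  linarith

lemma meanCurv_eq (h : IsCylinderJet g q w τ N k m) {Hq : V6} (hH : IsMeanCurvAt g q Hq) :
    Hq = Jc (tangentVec w τ N m 0 0 (k / (1 + m ^ 2))) := by
  obtain ⟨v₁, v₂, v₃, ⟨h11, h22, h33, h12, h13, h23⟩, n₁, n₂, n₃, hn₁, hn₂, hn₃, rfl⟩ := hH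
  have hnorm : IsNormalAt g q (n₁ + n₂ + n₃) := fun v => by
    rw [ip6_add_left, ip6_add_left, hn₁.1 v, hn₂.1 v, hn₃.1 v, add_zero, add_zero]
  obtain ⟨α, β, s, hH⟩ := h.exists_eq_Jc_tangentVec_of_isNormalAt hnorm
  have hpair (α' β' s' : ℝ) := ip6_add_left (n₁ + n₂) n₃ (Jc (tangentVec w τ N m α' β' s'))
  simp only [ip6_add_left n₁, h.ip6_sff_self hn₁, h.ip6_sff_self hn₂, h.ip6_sff_self hn₃, hH,
    h.ip6_Jc_tangentVec_Jc_tangentVec] at hpair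
  rw [hH]
  rw [h.fderiv_eq v₁, h.fderiv_eq v₂, h.ip6_tangentVec] at h12
  rw [h.fderiv_eq v₁, h.fderiv_eq v₃, h.ip6_tangentVec] at h13
  rw [h.fderiv_eq v₂, h.fderiv_eq v₃, h.ip6_tangentVec] at h23
  rw [h.fderiv_eq v₁, h.ip6_tangentVec] at h11
  rw [h.fderiv_eq v₂, h.ip6_tangentVec] at h22
  rw [h.fderiv_eq v₃, h.ip6_tangentVec] at h33
  generalize ⟪w, (fderiv ℝ g q v₁).1⟫_ℝ = a₁ at *
  generalize ⟪w, (fderiv ℝ g q v₂).1⟫_ℝ = a₂ at *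
  generalize ⟪w, (fderiv ℝ g q v₃).1⟫_ℝ = a₃ at *
  generalize ⟪τ, (fderiv ℝ g q v₁).1⟫_ℝ = b₁ at *
  generalize ⟪τ, (fderiv ℝ g q v₂).1⟫_ℝ = b₂ at *
  generalize ⟪τ, (fderiv ℝ g q v₃).1⟫_ℝ = b₃ at *
  obtain ⟨hbb, hsb⟩ := sum_sq_of_orthonormal_rows (m := m) (α := ![a₁, a₂, a₃])
    (β := ![b₁, b₂, b₃]) (s := ![v₁.2, v₂.2, v₃.2]) (by
      intro i j
      fin_cases i <;> fin_cases j <;> simp <;> linarith)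
  simp only [Fin.sum_univ_three, Matrix.cons_val] at hbb hsb
  have hm : 1 + m ^ 2 ≠ 0 := by positivity
  have hα : α = 0 := by simpa using hpair 1 0 0
  have hβ : β = 0 := by
    have h0 : (1 + m ^ 2) * β = 0 := by
      have := hpair 0 1 0
      linear_combination this + 2 * k * hsb
    exact (mul_eq_zero.1 h0).resolve_left hm
  have hs : s = k / (1 + m ^ 2) := by
    rw [eq_div_iff hm]
    linear_combination (1 + m ^ 2) * hpair 0 0 1 + k * hbb
  rw [hα, hβ, hs]

lemma exists_sff_vertical (h : IsCylinderJet g q w τ N k m) (s : ℝ) (v : W3) :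
    ∃ β, IsSFF g q (0, s) v (Jc (tangentVec w τ N m 0 β 0)) := by
  have hm : 1 + m ^ 2 ≠ 0 := by positivity
  set β := s * k * ⟪τ, (fderiv ℝ g q v).1⟫_ℝ with hβ
  refine ⟨β / (1 + m ^ 2), h.isNormalAt_Jc_tangentVec _ _ _, ?_⟩
  obtain ⟨z, hz⟩ := h.exists_fderiv_eq 0 (m * β / (1 + m ^ 2)) 0
  refine ⟨z, ?_⟩
  rw [hz, h.d2_vertical, ← hβ]
  simp only [tangentVec, Jc]
  refine Prod.ext ?_ ?_
  · simp [mul_div_assoc]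
  · simp only [Prod.snd_sub]
    match_scalars
    · field_simp
      ring
    · simp
    · simp

lemma maslovianAt (h : IsCylinderJet g q w τ N k m) {Hq : V6} (hH : IsMeanCurvAt g q Hq) :
    MaslovianAt g q Hq := by
  have hm : 1 + m ^ 2 ≠ 0 := by positivity
  have hl : k / (1 + m ^ 2) ≠ 0 := div_ne_zero h.k_ne_zero hm
  rw [h.meanCurv_eq hH]
  set l := k / (1 + m ^ 2)
  constructor
  · intro h0
    have h1 := h.ip6_Jc_tangentVec_Jc_tangentVec m 0 0 l 0 0 l
    rw [h0] at h1
    simp [ip6, hl] at h1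
  · intro V u hV hu
    have hV' : V = (0, -l) := h.injective (by
      rw [hV, h.fderiv_vertical]
      simp [Jc, tangentVec])
    obtain ⟨β, hβ⟩ := h.exists_sff_vertical (-l) u
    rw [hV'] at hu
    have h0 := hu u _ hβ
    rw [h.ip6_Jc_tangentVec_Jc_tangentVec] at h0
    have hu0 : u = 0 := h.injective (by
      rw [map_zero]
      exact eq_zero_of_ip6_self_eq_zero (by linarith))
    exact ⟨0, by rw [hu0, zero_smul]⟩

end IsCylinderJet
end PointwiseAlgebra

/-- The normal bundle immersion of a surface in a circular cylinder has, at each point, the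
second order data described by `IsCylinderJet`. -/
lemma SurfaceData.isCylinderJet_nbi {U : Set (ℝ × ℝ)} {x N : ℝ × ℝ → E3}
    (hS : SurfaceData U x N) {c w : E3} {k : ℝ} (hw : ⟪w, w⟫_ℝ = 1) (hk0 : k ≠ 0)
    (hk : ∀ p ∈ U, N p = k • projPerp w (x p - c)) {q : W3} (hq : q.1 ∈ U) :
    ∃ τ, IsCylinderJet (nbi x N) q w τ (N q.1) k (q.2 * k) := by
  have hNN : ⟪N q.1, N q.1⟫_ℝ = 1 := by
    rw [real_inner_self_eq_norm_sq, hS.unit_N _ hq]; norm_num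
  have hwN : ⟪w, N q.1⟫_ℝ = 0 := by
    rw [hk _ hq, inner_smul_right, projPerp_apply, inner_sub_right, inner_smul_right, hw]
    ring
  obtain ⟨τ, h⟩ := exists_isOrthoFrame hw hNN hwN
  have hfst (v : W3) : (fderiv ℝ (nbi x N) q v).1 = fderiv ℝ x q.1 v.1 := by
    rw [hS.fderiv_nbi hk hq]
  have hLexp (a : ℝ × ℝ) : fderiv ℝ x q.1 a =
      ⟪w, fderiv ℝ x q.1 a⟫_ℝ • w + ⟪τ, fderiv ℝ x q.1 a⟫_ℝ • τ := by
    refine (h.expand _).trans ?_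
    rw [hS.normal_N _ hq, zero_smul, add_zero]
  have hPL (a : ℝ × ℝ) : projPerp w (fderiv ℝ x q.1 a) = ⟪τ, fderiv ℝ x q.1 a⟫_ℝ • τ := by
    rw [projPerp_apply, sub_eq_iff_eq_add']
    exact hLexp a
  have hfd (v : W3) : fderiv ℝ (nbi x N) q v = tangentVec w τ (N q.1) (q.2 * k)
      ⟪w, (fderiv ℝ (nbi x N) q v).1⟫_ℝ ⟪τ, (fderiv ℝ (nbi x N) q v).1⟫_ℝ v.2 := by
    rw [hfst, hS.fderiv_nbi hk hq, hPL, tangentVec, ← hLexp, mul_smul (q.2 * k)]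
  refine ⟨τ, h, hk0, ?_, hfd, ?_, ?_, ?_, ?_⟩
  · refine (injective_iff_map_eq_zero _).2 fun v hv => ?_
    have hv1 : v.1 = 0 := hS.immersion _ hq (by rw [← hfst, hv, map_zero]; rfl)
    have hv2 := congrArg (fun z : V6 => ⟪N q.1, z.2⟫_ℝ) hv
    rw [hS.fderiv_nbi hk hq, hv1] at hv2
    refine Prod.ext hv1 ?_
    simpa [-inner_self_eq_norm_sq_to_K, inner_smul_right, hNN] using hv2
  · intro α β s
    obtain ⟨a, ha⟩ := exists_preimage_of_inner_eq_zero (v := α • w + β • τ)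
      (hS.immersion _ hq) hNN (hS.normal_N _ hq)
      (by rw [inner_add_right, inner_smul_right, inner_smul_right, h.Nw, h.Nτ]; ring)
    refine ⟨(a, s), ?_⟩
    rw [hfd, hfst, ha]
    simp only [inner_add_right, inner_smul_right, h.ww, h.wτ, h.τw, h.ττ]
    simp
  · intro s
    rw [hfd, hfst]
    simp
  · intro v α β s
    rw [hfst, hS.d2_nbi hk hq, hPL]
    have hNB := hS.inner_normal_fderiv_fderiv hk hq v.1 v.1
    rw [hPL, inner_smul_left, conj_trivial] at hNB
    simp only [projPerp_apply, ip6, Jc, tangentVec, inner_add_left, inner_sub_left,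
      inner_add_right, inner_neg_right, inner_smul_left, inner_smul_right, conj_trivial, h.ww,
      h.wτ, h.τw, h.ττ]
    rw [real_inner_comm (N q.1), hNB, real_inner_comm w]
    ring
  · intro s v
    rw [hfst, hS.d2_nbi hk hq, hPL]
    simp [smul_smul]

/-- If `x(U)` is contained in a circular cylinder, then the normal bundle
immersion is a Maslovian Lagrangian immersion into ℂ³. -/
theorem cylinder_normal_bundle_maslovian (U : Set (ℝ × ℝ)) (x N : ℝ × ℝ → E3)
    (hS : SurfaceData U x N) (c w : E3) (ρ : ℝ) (hw : ‖w‖ = 1) (hρ : 0 < ρ)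
    (hcyl : ∀ p ∈ U, ‖(x p - c) - ⟪x p - c, w⟫_ℝ • w‖ = ρ) :
    ∀ q : W3, q.1 ∈ U → LagrangianAt (nbi x N) q ∧
      ∀ Hq : V6, IsMeanCurvAt (nbi x N) q Hq → MaslovianAt (nbi x N) q Hq := by
  have hww : ⟪w, w⟫_ℝ = 1 := by rw [real_inner_self_eq_norm_sq, hw]; norm_num
  obtain ⟨k, hk0, hk⟩ := hS.exists_normal_eq_smul hww hρ fun p hp => by
    rw [projPerp_apply, real_inner_comm, hcyl p hp]
  intro q hq
  obtain ⟨τ, h⟩ := hS.isCylinderJet_nbi hww hk0 hk hq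
  exact ⟨h.lagrangianAt, fun Hq hH => h.maslovianAt hH⟩
end
end

section
/- Let x: U → ℝ³ be a smooth immersed surface with unit normal N whose image x(U) is contained in a round sphere, a circular cylinder, or a circular cone, and let f(p,t) = (x(p), t·N(p)) be the normal bundle immersion with mean curvature vector H. Then at every point of U × ℝ the tangent vector A_H(JH) vanishes; equivalently, the tangential component of the directional derivative of the ℝ⁶-valued function H along the tangent direction corresponding to JH is zero. -/
noncomputable section

open scoped InnerProductSpace

open Filter Topology

/-- Second derivative of `F` at `p` in directions `v`, `w`. -/
def secondDeriv (F : ℝ × ℝ → E3) (p v w : ℝ × ℝ) : E3 :=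
  fderiv ℝ (fun y => fderiv ℝ F y w) p v

/-- The bilinear form `⟨dN(v), dx(w)⟩`: minus the second fundamental form of the surface. -/
def weingarten (x N : ℝ × ℝ → E3) (p v w : ℝ × ℝ) : ℝ :=
  ⟪fderiv ℝ N p v, fderiv ℝ x p w⟫_ℝ

/-- `v₀` is a direction in the kernel of the symmetric form `weingarten x N p` such that the
covariant derivative of that form is its symmetric product with the metric dual of `v₀`. -/
structure SplitsAlong (x N : ℝ × ℝ → E3) (p v₀ : ℝ × ℝ) : Prop where
  kernel : fderiv ℝ N p v₀ = 0
  symm : ∀ v w, weingarten x N p v w = weingarten x N p w v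
  split : ∀ v w y, ⟪secondDeriv N p v w, fderiv ℝ x p y⟫_ℝ -
      ⟪secondDeriv x p v w, fderiv ℝ N p y⟫_ℝ =
    weingarten x N p v w * ⟪fderiv ℝ x p v₀, fderiv ℝ x p y⟫_ℝ +
    weingarten x N p v y * ⟪fderiv ℝ x p v₀, fderiv ℝ x p w⟫_ℝ +
    weingarten x N p w y * ⟪fderiv ℝ x p v₀, fderiv ℝ x p v⟫_ℝ

section Calculus

variable {E : Type*} [NormedAddCommGroup E] [NormedSpace ℝ E]

theorem ContDiffAt.differentiableAt_fderiv_apply {F : ℝ × ℝ → E} {p : ℝ × ℝ}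
    (hF : ContDiffAt ℝ 2 F p) (w : ℝ × ℝ) :
    DifferentiableAt ℝ (fun y => fderiv ℝ F y w) p :=
  ((hF.fderiv_right (m := 1) (by norm_num)).differentiableAt (by norm_num)).clm_apply
    (differentiableAt_const w)

theorem ContDiffAt.eventually_differentiableAt {F : ℝ × ℝ → E} {p : ℝ × ℝ}
    (hF : ContDiffAt ℝ 2 F p) : ∀ᶠ y in 𝓝 p, DifferentiableAt ℝ F y :=
  (hF.eventually (by simp)).mono fun _ h => h.differentiableAt (by norm_num)

end Calculus

namespace SurfaceData

variable {U : Set (ℝ × ℝ)} {x N : ℝ × ℝ → E3} {p : ℝ × ℝ}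

theorem eventually_mem (hS : SurfaceData U x N) (hp : p ∈ U) : ∀ᶠ y in 𝓝 p, y ∈ U :=
  hS.open_U.mem_nhds hp

theorem contDiffAt_x (hS : SurfaceData U x N) (hp : p ∈ U) : ContDiffAt ℝ 2 x p :=
  (hS.smooth_x.contDiffAt (hS.open_U.mem_nhds hp)).of_le (WithTop.coe_le_coe.2 le_top)

theorem contDiffAt_N (hS : SurfaceData U x N) (hp : p ∈ U) : ContDiffAt ℝ 2 N p :=
  (hS.smooth_N.contDiffAt (hS.open_U.mem_nhds hp)).of_le (WithTop.coe_le_coe.2 le_top)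

theorem differentiableAt_x (hS : SurfaceData U x N) (hp : p ∈ U) : DifferentiableAt ℝ x p :=
  (hS.contDiffAt_x hp).differentiableAt (by norm_num)

theorem differentiableAt_N (hS : SurfaceData U x N) (hp : p ∈ U) : DifferentiableAt ℝ N p :=
  (hS.contDiffAt_N hp).differentiableAt (by norm_num)

theorem inner_N_self (hS : SurfaceData U x N) (hp : p ∈ U) : ⟪N p, N p⟫_ℝ = 1 := by
  rw [real_inner_self_eq_norm_sq, hS.unit_N p hp, one_pow]

theorem inner_N_fderiv_N (hS : SurfaceData U x N) (hp : p ∈ U) (v : ℝ × ℝ) :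
    ⟪N p, fderiv ℝ N p v⟫_ℝ = 0 := by
  have hN := hS.differentiableAt_N hp
  have h : (fun y => ⟪N y, N y⟫_ℝ) =ᶠ[𝓝 p] fun _ => 1 :=
    (hS.eventually_mem hp).mono fun y hy => hS.inner_N_self hy
  have h1 := fderiv_inner_apply ℝ hN hN v
  rw [h.fderiv_eq, real_inner_comm] at h1
  simp at h1
  linarith [real_inner_comm (N p) (fderiv ℝ N p v)]

theorem inner_N_secondDeriv (hS : SurfaceData U x N) (hp : p ∈ U) (v w : ℝ × ℝ) :
    ⟪secondDeriv x p v w, N p⟫_ℝ = -weingarten x N p v w := by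
  have h : (fun y => ⟪N y, fderiv ℝ x y w⟫_ℝ) =ᶠ[𝓝 p] fun _ => 0 :=
    (hS.eventually_mem hp).mono fun y hy => hS.normal_N y hy w
  have h1 := fderiv_inner_apply ℝ (hS.differentiableAt_N hp)
    ((hS.contDiffAt_x hp).differentiableAt_fderiv_apply w) v
  rw [h.fderiv_eq] at h1
  simp at h1
  rw [real_inner_comm]
  unfold secondDeriv weingarten
  linarith

theorem exists_fderiv_eq (hS : SurfaceData U x N) (hp : p ∈ U) {z : E3}
    (hz : ⟪N p, z⟫_ℝ = 0) : ∃ v, fderiv ℝ x p v = z := by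
  have hN : N p ≠ 0 := by
    intro h
    have := hS.unit_N p hp
    simp [h] at this
  have hle : LinearMap.range (fderiv ℝ x p : ℝ × ℝ →ₗ[ℝ] E3) ≤ (ℝ ∙ N p)ᗮ := by
    rintro _ ⟨v, rfl⟩
    exact Submodule.mem_orthogonal_singleton_iff_inner_right.2 (hS.normal_N p hp v)
  have : Fact (Module.finrank ℝ E3 = 2 + 1) := ⟨by simp⟩
  have heq := Submodule.eq_of_le_of_finrank_eq hle (by
    rw [Submodule.finrank_orthogonal_span_singleton (n := 2) hN,
      LinearMap.finrank_range_of_inj (hS.immersion p hp)]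
    simp)
  have : z ∈ LinearMap.range (fderiv ℝ x p : ℝ × ℝ →ₗ[ℝ] E3) := by
    rw [heq]
    exact Submodule.mem_orthogonal_singleton_iff_inner_right.2 hz
  exact this

/-- A vector orthogonal to the tangent plane is a multiple of the unit normal. -/
theorem eq_smul_normal (hS : SurfaceData U x N) (hp : p ∈ U) {n : E3}
    (hn : ∀ v, ⟪n, fderiv ℝ x p v⟫_ℝ = 0) : n = ⟪N p, n⟫_ℝ • N p := by
  obtain ⟨v, hv⟩ := hS.exists_fderiv_eq hp (z := n - ⟪N p, n⟫_ℝ • N p) (by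
    rw [inner_sub_right, inner_smul_right, hS.inner_N_self hp]; ring)
  rw [← sub_eq_zero, ← inner_self_eq_zero (𝕜 := ℝ)]
  nth_rewrite 2 [← hv]
  rw [inner_sub_left, inner_smul_left, hn, hS.normal_N p hp]
  simp

/-- Two unit normal fields agree locally up to a constant sign. -/
theorem eventually_eq_smul (hS : SurfaceData U x N) (hp : p ∈ U) {n : ℝ × ℝ → E3}
    (hc : ContinuousAt n p)
    (hn : ∀ y ∈ U, ⟪n y, n y⟫_ℝ = 1 ∧ ∀ v, ⟪n y, fderiv ℝ x y v⟫_ℝ = 0) :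
    ∃ ε : ℝ, ε ^ 2 = 1 ∧ ∀ᶠ y in 𝓝 p, N y = ε • n y := by
  have hsq : ∀ y ∈ U, ⟪N y, n y⟫_ℝ ^ 2 = 1 := by
    intro y hy
    have h1 := (hn y hy).1
    rw [hS.eq_smul_normal hy (hn y hy).2, inner_smul_left, inner_smul_right,
      hS.inner_N_self hy] at h1
    simp at h1
    nlinarith
  have hcont : ContinuousAt (fun y => ⟪N p, n p⟫_ℝ * ⟪N y, n y⟫_ℝ) p :=
    continuousAt_const.mul ((hS.differentiableAt_N hp).continuousAt.inner hc)
  have hpos : ∀ᶠ y in 𝓝 p, 0 < ⟪N p, n p⟫_ℝ * ⟪N y, n y⟫_ℝ :=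
    hcont.eventually (lt_mem_nhds (by nlinarith [hsq p hp]))
  refine ⟨⟪N p, n p⟫_ℝ, hsq p hp, ?_⟩
  filter_upwards [hpos, hS.eventually_mem hp] with y hy hyU
  have hs : ⟪N p, n p⟫_ℝ * ⟪N y, n y⟫_ℝ = 1 := by
    have : (⟪N p, n p⟫_ℝ * ⟪N y, n y⟫_ℝ) ^ 2 = 1 := by
      rw [mul_pow, hsq p hp, hsq y hyU, one_mul]
    nlinarith
  rw [hS.eq_smul_normal hyU (hn y hyU).2, smul_smul, hs, one_smul]

/-- The case where the unit normal is locally a symmetric affine function of the position. -/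
theorem splitsAlong_of_affine (hS : SurfaceData U x N) (hp : p ∈ U) (A : E3) (B : E3 →L[ℝ] E3)
    (hB : ∀ a b, ⟪B a, b⟫_ℝ = ⟪a, B b⟫_ℝ) (h : ∀ᶠ y in 𝓝 p, N y = A + B (x y)) :
    SplitsAlong x N p 0 := by
  have hd : ∀ᶠ y in 𝓝 p, ∀ v, fderiv ℝ N y v = B (fderiv ℝ x y v) := by
    filter_upwards [h.eventually_nhds, (hS.contDiffAt_x hp).eventually_differentiableAt]
      with y hy hx v
    rw [Filter.EventuallyEq.fderiv_eq hy, fderiv_const_add]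
    exact congrArg (· v) (B.hasFDerivAt.comp y hx.hasFDerivAt).fderiv
  have hd0 := hd.self_of_nhds
  refine ⟨by simp, fun v w => ?_, fun v w y => ?_⟩
  · simp only [weingarten, hd0, hB]
    rw [real_inner_comm]
    exact (hB _ _).symm ▸ rfl
  · have h2 : secondDeriv N p v w = B (secondDeriv x p v w) := by
      unfold secondDeriv
      rw [Filter.EventuallyEq.fderiv_eq (hd.mono fun y hy => hy w)]
      exact congrArg (· v) (B.hasFDerivAt.comp p
        ((hS.contDiffAt_x hp).differentiableAt_fderiv_apply w).hasFDerivAt).fderiv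
    simp [h2, hd0, hB]

/-- The case where the surface is a cone over the normal image shifted by a constant. -/
theorem splitsAlong_of_cone (hS : SurfaceData U x N) (hp : p ∈ U) (A c : E3)
    (ρ : ℝ × ℝ → ℝ) (β : ℝ) (hρ : ContDiffAt ℝ 2 ρ p) (hρ0 : ρ p ≠ 0) (hβ : β ≠ 0)
    (hM : ∀ᶠ y in 𝓝 p, ⟪N y - A, N y - A⟫_ℝ = β)
    (hz : ∀ᶠ y in 𝓝 p, x y = c + ρ y • (N y - A))
    (htan : ⟪N p, N p - A⟫_ℝ = 0) : ∃ v₀, SplitsAlong x N p v₀ := by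
  have hNd := (hS.contDiffAt_N hp).eventually_differentiableAt
  have hMd : ∀ᶠ y in 𝓝 p, ∀ v, ⟪N y - A, fderiv ℝ N y v⟫_ℝ = 0 := by
    filter_upwards [hM.eventually_nhds, hNd] with y hy hN v
    have h1 := fderiv_inner_apply ℝ (hN.sub_const A) (hN.sub_const A) v
    rw [Filter.EventuallyEq.fderiv_eq hy, fderiv_sub_const] at h1
    simp at h1
    linarith [real_inner_comm (N y - A) (fderiv ℝ N y v)]
  have hxd : ∀ᶠ y in 𝓝 p, ∀ v, fderiv ℝ x y v =
      ρ y • fderiv ℝ N y v + fderiv ℝ ρ y v • (N y - A) := by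
    filter_upwards [hz.eventually_nhds, hNd, hρ.eventually_differentiableAt] with y hy hN hr v
    rw [Filter.EventuallyEq.fderiv_eq hy, fderiv_const_add, fderiv_fun_smul hr (hN.sub_const A),
      fderiv_sub_const]
    rfl
  have hx0 := hxd.self_of_nhds
  have hM0 := hMd.self_of_nhds
  have hMM := hM.self_of_nhds
  have hN2 : ∀ v w, ⟪secondDeriv N p v w, N p - A⟫_ℝ =
      -⟪fderiv ℝ N p v, fderiv ℝ N p w⟫_ℝ := by
    intro v w
    have h1 := fderiv_inner_apply ℝ ((hS.differentiableAt_N hp).sub_const A)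
      ((hS.contDiffAt_N hp).differentiableAt_fderiv_apply w) v
    rw [Filter.EventuallyEq.fderiv_eq (hMd.mono fun y hy => hy w), fderiv_sub_const] at h1
    simp at h1
    rw [real_inner_comm]
    unfold secondDeriv
    linarith
  have hx2 : ∀ v w, secondDeriv x p v w = ρ p • secondDeriv N p v w +
      fderiv ℝ ρ p v • fderiv ℝ N p w + fderiv ℝ ρ p w • fderiv ℝ N p v +
      fderiv ℝ (fun y => fderiv ℝ ρ y w) p v • (N p - A) := by
    intro v w
    have hN' := (hS.contDiffAt_N hp).differentiableAt_fderiv_apply w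
    have hρ' := hρ.differentiableAt_fderiv_apply w
    have hN := (hS.differentiableAt_N hp).sub_const A
    have hr := hρ.differentiableAt (by norm_num)
    unfold secondDeriv
    rw [Filter.EventuallyEq.fderiv_eq (hxd.mono fun y hy => hy w),
      fderiv_fun_add (hr.fun_smul hN') (hρ'.fun_smul hN), fderiv_fun_smul hr hN',
      fderiv_fun_smul hρ' hN, fderiv_sub_const]
    simp
    abel
  obtain ⟨v₀, hv₀⟩ := hS.exists_fderiv_eq hp (z := (-(ρ p * β)⁻¹) • (N p - A))
    (by rw [inner_smul_right, htan, mul_zero])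
  have hm : ∀ y, ⟪fderiv ℝ x p v₀, fderiv ℝ x p y⟫_ℝ = -(fderiv ℝ ρ p y / ρ p) := by
    intro y
    rw [hv₀, hx0, inner_smul_left, inner_add_right, inner_smul_right, inner_smul_right, hM0, hMM]
    simp
    field_simp
  have hII : ∀ v w, weingarten x N p v w = ρ p * ⟪fderiv ℝ N p v, fderiv ℝ N p w⟫_ℝ := by
    intro v w
    rw [weingarten, hx0, inner_add_right, inner_smul_right, inner_smul_right,
      real_inner_comm (N p - A), hM0]
    ring
  refine ⟨v₀, ?_, fun v w => ?_, fun v w y => ?_⟩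
  · have h1 : ρ p * ⟪fderiv ℝ N p v₀, fderiv ℝ N p v₀⟫_ℝ = 0 := by
      rw [← hII, weingarten, hv₀, inner_smul_right, real_inner_comm (N p - A), hM0, mul_zero]
    exact inner_self_eq_zero.1 ((mul_eq_zero.1 h1).resolve_left hρ0)
  · rw [hII, hII, real_inner_comm]
  · simp only [hm, hII]
    simp only [hx2, hx0 y, inner_add_left, inner_add_right, inner_smul_left,
      inner_smul_right, hN2, hM0, conj_trivial]
    field_simp
    ring

end SurfaceData

section EuclideanSix

theorem ip6_add_left_s12 (a b c : V6) : ip6 (a + b) c = ip6 a c + ip6 b c := by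
  simp only [ip6, Prod.fst_add, Prod.snd_add, inner_add_left]; ring

theorem ip6_add_right (a b c : V6) : ip6 a (b + c) = ip6 a b + ip6 a c := by
  simp only [ip6, Prod.fst_add, Prod.snd_add, inner_add_right]; ring

theorem ip6_smul_left (r : ℝ) (a b : V6) : ip6 (r • a) b = r * ip6 a b := by
  simp only [ip6, Prod.smul_fst, Prod.smul_snd, real_inner_smul_left]; ring

theorem ip6_comm (a b : V6) : ip6 a b = ip6 b a := by
  simp only [ip6, real_inner_comm]

theorem ip6_sub_left_s12 (a b c : V6) : ip6 (a - b) c = ip6 a c - ip6 b c := by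
  simp only [ip6, Prod.fst_sub, Prod.snd_sub, inner_sub_left]; ring

theorem ip6_smul_right (r : ℝ) (a b : V6) : ip6 a (r • b) = r * ip6 a b := by
  rw [ip6_comm, ip6_smul_left, ip6_comm]

theorem ip6_Jc_left (a b : V6) : ip6 (Jc a) b = -ip6 a (Jc b) := by
  simp only [ip6, Jc, inner_neg_left, inner_neg_right]; ring

theorem Jc_Jc (a : V6) : Jc (Jc a) = -a := rfl

theorem eq_zero_of_ip6_self {a : V6} (h : ip6 a a = 0) : a = 0 := by
  have h1 : 0 ≤ ⟪a.1, a.1⟫_ℝ := real_inner_self_nonneg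
  have h2 : 0 ≤ ⟪a.2, a.2⟫_ℝ := real_inner_self_nonneg
  unfold ip6 at h
  exact Prod.ext (inner_self_eq_zero (𝕜 := ℝ).1 (by linarith))
    (inner_self_eq_zero (𝕜 := ℝ).1 (by linarith))

/-- Expansion of a tangent vector in an orthonormal frame. -/
theorem ONFrame.expansion {g : W3 → V6} {q e₁ e₂ e₃ : W3} (h : ONFrame g q e₁ e₂ e₃) (X : W3) :
    X = ip6 (fderiv ℝ g q X) (fderiv ℝ g q e₁) • e₁ +
      ip6 (fderiv ℝ g q X) (fderiv ℝ g q e₂) • e₂ +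
      ip6 (fderiv ℝ g q X) (fderiv ℝ g q e₃) • e₃ := by
  obtain ⟨h11, h22, h33, h12, h13, h23⟩ := h
  have h21 := ip6_comm (fderiv ℝ g q e₂) (fderiv ℝ g q e₁)
  have h31 := ip6_comm (fderiv ℝ g q e₃) (fderiv ℝ g q e₁)
  have h32 := ip6_comm (fderiv ℝ g q e₃) (fderiv ℝ g q e₂)
  rw [h12] at h21
  rw [h13] at h31
  rw [h23] at h32
  have key : ∀ a b c : ℝ, ∀ Y : W3, a • e₁ + b • e₂ + c • e₃ = Y →
      a = ip6 (fderiv ℝ g q Y) (fderiv ℝ g q e₁) ∧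
      b = ip6 (fderiv ℝ g q Y) (fderiv ℝ g q e₂) ∧
      c = ip6 (fderiv ℝ g q Y) (fderiv ℝ g q e₃) := by
    rintro a b c _ rfl
    simp [ip6_add_left_s12, ip6_smul_left, h11, h22, h33, h12, h13, h23, h21, h31, h32]
  have hli : LinearIndependent ℝ ![e₁, e₂, e₃] := by
    rw [Fintype.linearIndependent_iff]
    intro c hc
    rw [Fin.sum_univ_three] at hc
    obtain ⟨h1, h2, h3⟩ := key _ _ _ _ hc
    have h0 : ∀ Z, ip6 (fderiv ℝ g q 0) Z = 0 := by simp [ip6]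
    intro i
    fin_cases i
    · exact h1.trans (h0 _)
    · exact h2.trans (h0 _)
    · exact h3.trans (h0 _)
  have hX : X ∈ Submodule.span ℝ (Set.range ![e₁, e₂, e₃]) := by
    rw [hli.span_eq_top_of_card_eq_finrank (by simp)]
    trivial
  obtain ⟨c, hc⟩ := (Submodule.mem_span_range_iff_exists_fun ℝ).1 hX
  rw [Fin.sum_univ_three] at hc
  obtain ⟨h1, h2, h3⟩ := key _ _ _ _ hc
  rw [← h1, ← h2, ← h3]
  exact hc.symm

/-- The normal projection of the second derivative exists. -/
theorem ONFrame.exists_isSFF {g : W3 → V6} {q e₁ e₂ e₃ : W3} (h : ONFrame g q e₁ e₂ e₃)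
    (v w : W3) : ∃ n, IsSFF g q v w n := by
  set D := d2 g q v w
  set F := fderiv ℝ g q
  refine ⟨D - F (ip6 D (F e₁) • e₁ + ip6 D (F e₂) • e₂ + ip6 D (F e₃) • e₃), fun X => ?_, ?_⟩
  · have hX := congrArg F (h.expansion X)
    simp only [map_add, map_smul] at hX
    have h1 : ip6 D (F X) = ip6 (F X) (F e₁) * ip6 D (F e₁) + ip6 (F X) (F e₂) * ip6 D (F e₂) +
        ip6 (F X) (F e₃) * ip6 D (F e₃) := by
      conv_lhs => rw [hX]
      simp only [ip6_add_right, ip6_smul_right]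
      rfl
    change ip6 _ (F X) = 0
    simp only [ip6_sub_left_s12, map_add, map_smul, ip6_add_left_s12, ip6_smul_left, h1,
      ip6_comm (F X)]
    ring
  · exact ⟨_, (sub_sub_cancel _ _).symm⟩

theorem IsMeanCurvAt.isNormalAt {g : W3 → V6} {q : W3} {Hq : V6} (h : IsMeanCurvAt g q Hq) :
    IsNormalAt g q Hq := by
  obtain ⟨_, _, _, _, n₁, n₂, n₃, h1, h2, h3, rfl⟩ := h
  intro v
  rw [ip6_add_left_s12, ip6_add_left_s12, h1.1 v, h2.1 v, h3.1 v]
  simp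

end EuclideanSix

namespace SurfaceData

variable {U : Set (ℝ × ℝ)} {x N : ℝ × ℝ → E3} {q : W3}

theorem fderiv_nbi_s12 (hS : SurfaceData U x N) (hq : q.1 ∈ U) (V : W3) :
    fderiv ℝ (nbi x N) q V =
      (fderiv ℝ x q.1 V.1, q.2 • fderiv ℝ N q.1 V.1 + V.2 • N q.1) := by
  have hx := (hS.differentiableAt_x hq).hasFDerivAt.comp q hasFDerivAt_fst
  have hN := (hS.differentiableAt_N hq).hasFDerivAt.comp q hasFDerivAt_fst
  exact congrArg (· V) (hx.prodMk (hasFDerivAt_snd.smul hN)).fderiv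

theorem hasFDerivAt_fderiv_nbi (hS : SurfaceData U x N) (hq : q.1 ∈ U) (W : W3) :
    ∃ L : W3 →L[ℝ] V6, HasFDerivAt (fun y => fderiv ℝ (nbi x N) y W) L q ∧
      ∀ V, L V = (secondDeriv x q.1 V.1 W.1,
        (q.2 • secondDeriv N q.1 V.1 W.1 + V.2 • fderiv ℝ N q.1 W.1) +
          W.2 • fderiv ℝ N q.1 V.1) := by
  have hx := ((hS.contDiffAt_x hq).differentiableAt_fderiv_apply W.1).hasFDerivAt.comp q
    hasFDerivAt_fst
  have hN' := ((hS.contDiffAt_N hq).differentiableAt_fderiv_apply W.1).hasFDerivAt.comp q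
    hasFDerivAt_fst
  have hN := (hS.differentiableAt_N hq).hasFDerivAt.comp q hasFDerivAt_fst
  have h := hx.prodMk ((hasFDerivAt_snd.smul hN').add (hN.const_smul W.2))
  refine ⟨_, h.congr_of_eventuallyEq ?_, fun V => rfl⟩
  filter_upwards [continuousAt_fst.eventually (hS.eventually_mem hq)] with y hy
  exact hS.fderiv_nbi_s12 hy W

theorem d2_nbi_s12 (hS : SurfaceData U x N) (hq : q.1 ∈ U) (V W : W3) :
    d2 (nbi x N) q V W = (secondDeriv x q.1 V.1 W.1,
        (q.2 • secondDeriv N q.1 V.1 W.1 + V.2 • fderiv ℝ N q.1 W.1) +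
          W.2 • fderiv ℝ N q.1 V.1) := by
  obtain ⟨L, hL, h⟩ := hS.hasFDerivAt_fderiv_nbi hq W
  rw [d2, hL.fderiv, h]

theorem fderiv_nbi_injective (hS : SurfaceData U x N) (hq : q.1 ∈ U) {V : W3}
    (h : fderiv ℝ (nbi x N) q V = 0) : V = 0 := by
  rw [hS.fderiv_nbi_s12 hq, Prod.mk_eq_zero] at h
  have h1 : V.1 = 0 := hS.immersion _ hq (h.1.trans (map_zero _).symm)
  have h2 : V.2 = 0 := by
    have h3 := congrArg (fun z => ⟪N q.1, z⟫_ℝ) h.2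
    simpa [h1, inner_smul_right, hS.unit_N _ hq] using h3
  exact Prod.ext h1 h2

/-- The second derivative along the normal bundle paired with `J df` is a symmetric product of
the second fundamental form of the surface and a linear form. -/
theorem ip6_d2_Jc (hS : SurfaceData U x N) (hq : q.1 ∈ U) {v₀ : ℝ × ℝ}
    (h : SplitsAlong x N q.1 v₀) (X Y Z : W3) :
    ip6 (d2 (nbi x N) q X Y) (Jc (fderiv ℝ (nbi x N) q Z)) =
      ip6 (fderiv ℝ (nbi x N) q (q.2 • v₀, 1)) (fderiv ℝ (nbi x N) q X) *
        weingarten x N q.1 Y.1 Z.1 +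
      ip6 (fderiv ℝ (nbi x N) q (q.2 • v₀, 1)) (fderiv ℝ (nbi x N) q Y) *
        weingarten x N q.1 X.1 Z.1 +
      ip6 (fderiv ℝ (nbi x N) q (q.2 • v₀, 1)) (fderiv ℝ (nbi x N) q Z) *
        weingarten x N q.1 X.1 Y.1 := by
  have hL : ∀ W : W3, ip6 (fderiv ℝ (nbi x N) q (q.2 • v₀, 1)) (fderiv ℝ (nbi x N) q W) =
      q.2 * ⟪fderiv ℝ x q.1 v₀, fderiv ℝ x q.1 W.1⟫_ℝ + W.2 := by
    intro W
    rw [hS.fderiv_nbi_s12 hq, hS.fderiv_nbi_s12 hq]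
    simp [ip6, h.kernel, inner_add_right, inner_smul_left, inner_smul_right,
      hS.inner_N_fderiv_N hq, hS.unit_N _ hq]
  rw [hL, hL, hL, hS.d2_nbi_s12 hq, hS.fderiv_nbi_s12 hq]
  have h1 := h.split X.1 Y.1 Z.1
  have h2 := hS.inner_N_secondDeriv hq X.1 Y.1
  simp only [ip6, Jc, inner_neg_right, inner_add_left, inner_add_right, real_inner_smul_left,
    real_inner_smul_right, h2]
  simp only [weingarten] at h1 ⊢
  linear_combination q.2 * h1

theorem ip6_fderiv_Jc (hS : SurfaceData U x N) (hq : q.1 ∈ U) {v₀ : ℝ × ℝ}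
    (h : SplitsAlong x N q.1 v₀) (X Y : W3) :
    ip6 (fderiv ℝ (nbi x N) q X) (Jc (fderiv ℝ (nbi x N) q Y)) = 0 := by
  have h1 := h.symm X.1 Y.1
  have h2 := hS.normal_N _ hq X.1
  have h3 := hS.normal_N _ hq Y.1
  rw [hS.fderiv_nbi_s12 hq, hS.fderiv_nbi_s12 hq]
  simp only [ip6, Jc, inner_neg_right, inner_add_left, inner_add_right, real_inner_smul_left,
    real_inner_smul_right, h3, real_inner_comm (N q.1), h2]
  simp only [weingarten] at h1
  rw [real_inner_comm (fderiv ℝ N q.1 Y.1), h1]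
  ring

/-- The mean curvature vector `H` satisfies `⟨h(V, ·), H⟩ = 0` for `V` corresponding to `JH`. -/
theorem ip6_d2_meanCurv (hS : SurfaceData U x N) (hq : q.1 ∈ U) {v₀ : ℝ × ℝ}
    (h : SplitsAlong x N q.1 v₀) {Hq : V6} (hH : IsMeanCurvAt (nbi x N) q Hq) {V : W3}
    (hV : fderiv ℝ (nbi x N) q V = Jc Hq) (W : W3) : ip6 (d2 (nbi x N) q V W) Hq = 0 := by
  obtain ⟨e₁, e₂, e₃, he, n₁, n₂, n₃, h1, h2, h3, hsum⟩ := hH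
  set II := weingarten x N q.1 with hII
  set F := fderiv ℝ (nbi x N) q with hF
  set L : W3 := (q.2 • v₀, 1) with hL
  have hn : ∀ e n, IsSFF (nbi x N) q e e n → ∀ Z, ip6 n (Jc (F Z)) =
      2 * (ip6 (F L) (F e) * II e.1 Z.1) + ip6 (F L) (F Z) * II e.1 e.1 := by
    intro e n hen Z
    obtain ⟨X, hX⟩ := hen.2
    have hz := hS.ip6_fderiv_Jc hq h X Z
    rw [hX, ip6_sub_left_s12, hS.ip6_d2_Jc hq h] at hz
    linarith
  have hexp := congrArg Prod.fst (he.expansion L)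
  have hLW : ∀ Z : W3, ip6 (F L) (F e₁) * II e₁.1 Z.1 + ip6 (F L) (F e₂) * II e₂.1 Z.1 +
      ip6 (F L) (F e₃) * II e₃.1 Z.1 = 0 := by
    intro Z
    have h0 : II L.1 Z.1 = 0 := by simp [hII, weingarten, hL, h.kernel]
    rw [hexp] at h0
    simpa [hII, weingarten, inner_add_left, real_inner_smul_left] using h0
  set τ := II e₁.1 e₁.1 + II e₂.1 e₂.1 + II e₃.1 e₃.1 with hτ
  have hVW : ∀ Z, ip6 (F (V + τ • L)) (F Z) = 0 := by
    intro Z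
    rw [map_add, map_smul, ip6_add_left_s12, ip6_smul_left, hV, ip6_Jc_left, hsum, ip6_add_left_s12,
      ip6_add_left_s12, hn _ _ h1, hn _ _ h2, hn _ _ h3]
    linear_combination -2 * hLW Z
  have hVL : V + τ • L = 0 := hS.fderiv_nbi_injective hq (eq_zero_of_ip6_self (hVW _))
  have hNV : fderiv ℝ N q.1 V.1 = 0 := by
    rw [eq_neg_of_add_eq_zero_left hVL]
    simp [hL, h.kernel]
  have hHq : Hq = (-1 : ℝ) • Jc (F V) := by
    rw [hV, Jc_Jc]; simp
  rw [hHq, ip6_smul_right, hS.ip6_d2_Jc hq h, h.symm W.1 V.1]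
  simp [weingarten, hNV]

end SurfaceData

namespace SurfaceData

variable {U : Set (ℝ × ℝ)} {x N : ℝ × ℝ → E3} {p : ℝ × ℝ}

/-- The case where the image under an orthogonal projection lies in a sphere. -/
theorem splitsAlong_of_norm_proj (hS : SurfaceData U x N) (hp : p ∈ U) (c : E3)
    (B : E3 →L[ℝ] E3) (hB : ∀ a b, ⟪B a, b⟫_ℝ = ⟪a, B b⟫_ℝ) (hBB : ∀ a, B (B a) = B a)
    {ρ : ℝ} (hρ : 0 < ρ) (h : ∀ y ∈ U, ‖B (x y - c)‖ = ρ) : SplitsAlong x N p 0 := by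
  have hin : ∀ y ∈ U, ⟪B (x y - c), B (x y - c)⟫_ℝ = ρ ^ 2 := by
    intro y hy
    rw [real_inner_self_eq_norm_sq, h y hy]
  obtain ⟨ε, -, hN⟩ := hS.eventually_eq_smul hp (n := fun y => ρ⁻¹ • B (x y - c))
    (by have := (hS.differentiableAt_x hp).continuousAt; fun_prop) (by
      intro y hy
      refine ⟨?_, fun v => ?_⟩
      · rw [real_inner_smul_left, real_inner_smul_right, hin y hy]
        field_simp
      · have hd : HasFDerivAt (fun y => B (x y - c)) (B ∘L fderiv ℝ x y) y :=
          B.hasFDerivAt.comp y ((hS.differentiableAt_x hy).hasFDerivAt.sub_const c)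
        have h1 := fderiv_inner_apply ℝ hd.differentiableAt hd.differentiableAt v
        have hc : (fun y => ⟪B (x y - c), B (x y - c)⟫_ℝ) =ᶠ[𝓝 y] fun _ => ρ ^ 2 :=
          (hS.eventually_mem hy).mono hin
        rw [hc.fderiv_eq, hd.fderiv, real_inner_comm] at h1
        have h2 : ⟪B (x y - c), B (fderiv ℝ x y v)⟫_ℝ = 0 := by
          simp only [fderiv_fun_const, Pi.zero_apply, zero_apply,
            ContinuousLinearMap.comp_apply] at h1
          linarith [real_inner_comm (B (x y - c)) (B (fderiv ℝ x y v))]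
        rw [real_inner_smul_left, ← hBB, hB, h2, mul_zero])
  refine hS.splitsAlong_of_affine hp (-(ε * ρ⁻¹) • B c) ((ε * ρ⁻¹) • B) (fun a b => ?_)
    (hN.mono fun y hy => ?_)
  · simp [real_inner_smul_left, real_inner_smul_right, hB]
  · rw [hy, map_sub]
    simp only [smul_apply]
    module

theorem splitsAlong_of_inRoundSphere (hS : SurfaceData U x N) (hp : p ∈ U)
    (h : InRoundSphere U x) : SplitsAlong x N p 0 := by
  obtain ⟨c, ρ, hρ, h⟩ := h
  exact hS.splitsAlong_of_norm_proj hp c (ContinuousLinearMap.id ℝ E3) (fun _ _ => rfl)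
    (fun _ => rfl) hρ h

theorem splitsAlong_of_inCircularCylinder (hS : SurfaceData U x N) (hp : p ∈ U)
    (h : InCircularCylinder U x) : SplitsAlong x N p 0 := by
  obtain ⟨c, w, ρ, hw, hρ, h⟩ := h
  have hB : ∀ a, (ContinuousLinearMap.id ℝ E3 - (innerSL ℝ w).smulRight w) a =
      a - ⟪a, w⟫_ℝ • w := by
    intro a
    simp [real_inner_comm]
  refine hS.splitsAlong_of_norm_proj hp c
    (ContinuousLinearMap.id ℝ E3 - (innerSL ℝ w).smulRight w) (fun a b => ?_) (fun a => ?_) hρ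
    (fun y hy => by rw [hB]; exact h y hy)
  · rw [hB, hB, inner_sub_left, inner_sub_right, real_inner_smul_left, real_inner_smul_right,
      real_inner_comm b w]
    ring
  · rw [hB, hB, inner_sub_left, real_inner_smul_left, real_inner_self_eq_norm_sq, hw]
    simp

/-- A circular cone with apex `c` and axis `a` is the set of `z` with `|z - c|² = k ⟨z - c, a⟩²`
and `⟨z - c, a⟩ > 0`. -/
theorem exists_cone_equation (h : InCircularCone U x) :
    ∃ (c a : E3) (k : ℝ), 1 < k ∧ ⟪a, a⟫_ℝ = 1 ∧ ∀ y ∈ U, 0 < ⟪x y - c, a⟫_ℝ ∧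
      ⟪x y - c, x y - c⟫_ℝ = k * ⟪x y - c, a⟫_ℝ ^ 2 := by
  obtain ⟨r, hr, Φ, ⟨S, c, -, hΦ⟩, h⟩ := h
  refine ⟨c, S (EuclideanSpace.single 2 1), r ^ 2 + 1, by have := sq_pos_of_ne_zero hr; linarith,
    by simp, fun y hy => ?_⟩
  obtain ⟨z, ⟨s, θ, hs, h0, h1, h2⟩, hz⟩ := h y hy
  have hpos : 0 < r ^ 2 + 1 := by positivity
  have hsq := Real.sq_sqrt hpos.le
  have hsp := Real.sqrt_pos.2 hpos
  have hxy : x y - c = S z := by rw [← hz, hΦ]; abel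
  rw [hxy, LinearIsometryEquiv.inner_map_map, LinearIsometryEquiv.inner_map_map,
    EuclideanSpace.inner_single_right, real_inner_self_eq_norm_sq, EuclideanSpace.norm_sq_eq,
    Fin.sum_univ_three, h0, h1, h2]
  refine ⟨by simp; positivity, ?_⟩
  simp only [Real.norm_eq_abs, sq_abs, conj_trivial, one_mul, div_pow, hsq]
  field_simp
  linear_combination r ^ 2 * Real.sin_sq_add_cos_sq θ

theorem splitsAlong_of_inCircularCone (hS : SurfaceData U x N) (hp : p ∈ U)
    (h : InCircularCone U x) : ∃ v₀, SplitsAlong x N p v₀ := by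
  obtain ⟨c, a, k, hk, ha, h⟩ := exists_cone_equation h
  have hkk : 0 < k * (k - 1) := mul_pos (by linarith) (by linarith)
  obtain ⟨γ, hγ, hγ2⟩ : ∃ γ : ℝ, 0 < γ ∧ γ ^ 2 = k * (k - 1) :=
    ⟨_, Real.sqrt_pos.2 hkk, Real.sq_sqrt hkk.le⟩
  obtain ⟨ε, hε, hN⟩ := hS.eventually_eq_smul hp
    (n := fun y => γ⁻¹ • (k • a - (⟪x y - c, a⟫_ℝ)⁻¹ • (x y - c)))
    (by
      have hx := (hS.differentiableAt_x hp).continuousAt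
      have hi : ContinuousAt (fun y => (⟪x y - c, a⟫_ℝ)⁻¹) p :=
        ContinuousAt.inv₀ (by fun_prop) (h p hp).1.ne'
      fun_prop) (by
      intro y hy
      obtain ⟨h1, h2⟩ := h y hy
      have h3 := real_inner_comm (x y - c) a
      refine ⟨?_, fun v => ?_⟩
      · simp only [real_inner_smul_left, real_inner_smul_right, inner_sub_left (k • a),
          inner_sub_right _ (k • a), h2, ha, h3]
        field_simp
        linear_combination -hγ2
      · have hd := (hS.differentiableAt_x hy).sub_const c
        have e1 := fderiv_inner_apply ℝ hd hd v
        have hc : (fun y => ⟪x y - c, x y - c⟫_ℝ) =ᶠ[𝓝 y] fun y => k * ⟪x y - c, a⟫_ℝ ^ 2 :=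
          (hS.eventually_mem hy).mono fun y hy => (h y hy).2
        have hda : HasFDerivAt (fun y => ⟪x y - c, a⟫_ℝ)
            ((innerSL ℝ a) ∘L fderiv ℝ x y) y := by
          have := (innerSL ℝ a).hasFDerivAt.comp y
            ((hS.differentiableAt_x hy).hasFDerivAt.sub_const c)
          refine this.congr_of_eventuallyEq (Eventually.of_forall fun y => ?_)
          exact real_inner_comm _ _
        rw [hc.fderiv_eq, ((hda.pow 2).const_mul k).fderiv, fderiv_sub_const,
          real_inner_comm (x y - c)] at e1
        simp at e1
        rw [real_inner_smul_left, inner_sub_left (k • a), real_inner_smul_left,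
          real_inner_smul_left]
        field_simp
        linarith)
  have hNA : ∀ᶠ y in 𝓝 p, y ∈ U ∧
      N y - (ε * γ⁻¹ * k) • a = (-(ε * γ⁻¹ * (⟪x y - c, a⟫_ℝ)⁻¹)) • (x y - c) := by
    filter_upwards [hN, hS.eventually_mem hp] with y hy hyU
    refine ⟨hyU, ?_⟩
    rw [hy]
    module
  refine hS.splitsAlong_of_cone hp ((ε * γ⁻¹ * k) • a) c
    (fun y => -(ε * γ * ⟪x y - c, a⟫_ℝ)) (γ⁻¹ ^ 2 * k) ?_ ?_ (by positivity) ?_ ?_ ?_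
  · have := hS.contDiffAt_x hp
    exact (contDiffAt_const.mul ((this.sub contDiffAt_const).inner ℝ contDiffAt_const)).neg
  · have hε0 : ε ≠ 0 := by rintro rfl; norm_num at hε
    exact neg_ne_zero.2 (mul_ne_zero (mul_ne_zero hε0 hγ.ne') (h p hp).1.ne')
  · filter_upwards [hNA] with y hy
    obtain ⟨h1, h2⟩ := h y hy.1
    rw [hy.2, real_inner_smul_left, real_inner_smul_right, h2]
    field_simp
    linear_combination hε
  · filter_upwards [hNA] with y hy
    have h1 := (h y hy.1).1
    rw [hy.2, smul_smul]
    have : -(ε * γ * ⟪x y - c, a⟫_ℝ) * -(ε * γ⁻¹ * (⟪x y - c, a⟫_ℝ)⁻¹) = 1 := by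
      field_simp
      exact hε
    rw [this, one_smul]
    abel
  · obtain ⟨h1, h2⟩ := h p hp
    rw [hNA.self_of_nhds.2, hN.self_of_nhds]
    simp only [real_inner_smul_left, real_inner_smul_right, inner_sub_left (k • a), h2,
      real_inner_comm a (x p - c)]
    field_simp
    ring

theorem exists_splitsAlong (hS : SurfaceData U x N)
    (hgeo : InRoundSphere U x ∨ InCircularCylinder U x ∨ InCircularCone U x) (hp : p ∈ U) :
    ∃ v₀, SplitsAlong x N p v₀ := by
  rcases hgeo with h | h | h
  · exact ⟨0, hS.splitsAlong_of_inRoundSphere hp h⟩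
  · exact ⟨0, hS.splitsAlong_of_inCircularCylinder hp h⟩
  · exact hS.splitsAlong_of_inCircularCone hp h

end SurfaceData

/-- Differentiating `⟨H, df(w)⟩ = 0` for a normal field `H`. -/
theorem ip6_fderiv_eq_zero {g H : W3 → V6} {q V w : W3} (hH : DifferentiableAt ℝ H q)
    (hg : DifferentiableAt ℝ (fun y => fderiv ℝ g y w) q)
    (hn : ∀ᶠ y in 𝓝 q, IsNormalAt g y (H y)) (h0 : ip6 (d2 g q V w) (H q) = 0) :
    ip6 (fderiv ℝ H q V) (fderiv ℝ g q w) = 0 := by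
  have hH' := hH.hasFDerivAt
  have hg' := hg.hasFDerivAt
  have h := (hH'.fst.inner ℝ hg'.fst).add (hH'.snd.inner ℝ hg'.snd)
  have hc := h.unique ((hasFDerivAt_const (0 : ℝ) q).congr_of_eventuallyEq
    (hn.mono fun y hy => hy w))
  have hV := congrArg (· V) hc
  rw [ip6_comm] at h0
  simp only [ip6, d2] at h0 ⊢
  simp [fderivInnerCLM_apply] at hV
  linarith

/-- If `x(U)` is contained in a round sphere, a circular cylinder or a
circular cone, then `A_H(JH) = 0` at every point of the normal bundle; equivalently, the
tangential component of the directional derivative of `H` along the tangent direction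
corresponding to `JH` vanishes. -/
theorem normal_bundle_AH_JH_zero (U : Set (ℝ × ℝ)) (x N : ℝ × ℝ → E3)
    (hS : SurfaceData U x N)
    (hgeo : InRoundSphere U x ∨ InCircularCylinder U x ∨ InCircularCone U x)
    (H : W3 → V6) (hH : ∀ q : W3, q.1 ∈ U → IsMeanCurvAt (nbi x N) q (H q)) :
    ∀ q : W3, q.1 ∈ U →
      (∀ V u : W3, fderiv ℝ (nbi x N) q V = Jc (H q) →
        IsShapeAt (nbi x N) q (H q) V u → u = 0) ∧
      (∀ V : W3, fderiv ℝ (nbi x N) q V = Jc (H q) →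
        ∀ w : W3, ip6 (fderiv ℝ H q V) (fderiv ℝ (nbi x N) q w) = 0) := by
  intro q hq
  obtain ⟨v₀, hv⟩ := hS.exists_splitsAlong hgeo hq
  have key := fun V hV W => hS.ip6_d2_meanCurv hq hv (hH q hq) (V := V) hV W
  refine ⟨fun V u hV hu => ?_, fun V hV w => ?_⟩
  · obtain ⟨_, _, _, he, _⟩ := hH q hq
    obtain ⟨n, hn⟩ := he.exists_isSFF V u
    refine hS.fderiv_nbi_injective hq (eq_zero_of_ip6_self ?_)
    obtain ⟨X, hX⟩ := hn.2
    have h1 := (hH q hq).isNormalAt X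
    rw [ip6_comm, hX, ip6_sub_left_s12, key V hV u] at h1
    rw [hu u n hn]
    linarith
  · by_cases hd : DifferentiableAt ℝ H q
    · obtain ⟨L, hL, -⟩ := hS.hasFDerivAt_fderiv_nbi hq w
      exact ip6_fderiv_eq_zero hd hL.differentiableAt
        ((continuousAt_fst.eventually (hS.eventually_mem hq)).mono fun y hy =>
          (hH y hy).isNormalAt) (key V hV w)
    · rw [fderiv_zero_of_not_differentiableAt hd]
      simp [ip6]
end
end
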